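/- arXiv:math/0604037 — 9 statements merged into one kernel-verified Lean document; each statement's English description precedes it below -/
import Mathlib

section
/- Assume 0 ∉ S(G). Then S(G) is a left Ore set in A_0: (i) for every s ∈ S(G) and a_0 ∈ A_0 there exist s' ∈ S(G) and a_0' ∈ A_0 with s'·a_0 = a_0'·s (in fact s itself is normalizing, so one may take s' = s); and (ii) if a_0·s = 0 for some s ∈ S(G) and a_0 ∈ A_0, then s'·a_0 = 0 for some s' ∈ S(G). Moreover, for every d ∈ S(G×G) there exists a_0 ∈ A_0 such that a_0·d ∈ S(G) (so every element of S(G×G) becomes invertible in the left Ore localization S(G)⁻¹A_0). -/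
section Normalizing

variable {R : Type*}

theorem Submonoid.exists_mul_eq_mul_of_mem_closure [Monoid R] {X : Set R}
    (hX : ∀ x ∈ X, ∀ a, ∃ b, x * a = b * x) {s : R} (hs : s ∈ Submonoid.closure X) (a : R) :
    ∃ b, s * a = b * s := by
  induction hs using Submonoid.closure_induction generalizing a with
  | mem x hx => exact hX x hx a
  | one => exact ⟨a, by simp⟩
  | mul s t _ _ hs ht =>
    obtain ⟨b, hb⟩ := ht a
    obtain ⟨c, hc⟩ := hs b
    exact ⟨c, by rw [mul_assoc, hb, ← mul_assoc, hc, mul_assoc]⟩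

theorem Submonoid.exists_mul_eq_zero_of_mem_closure [MonoidWithZero R] {X : Set R}
    (hX : ∀ x ∈ X, ∀ a, a * x = 0 → x * a = 0) {s : R} (hs : s ∈ Submonoid.closure X) (a : R)
    (ha : a * s = 0) : ∃ t ∈ Submonoid.closure X, t * a = 0 := by
  induction hs using Submonoid.closure_induction_right generalizing a with
  | one => exact ⟨1, one_mem _, by simpa using ha⟩
  | mul_right s _ x hx ih =>
    have h := hX x hx (a * s) (by rw [mul_assoc, ha])
    obtain ⟨t, ht, hta⟩ := ih (x * a) (by rw [mul_assoc, h])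
    exact ⟨t * x, mul_mem ht (Submonoid.subset_closure hx), by rw [mul_assoc, hta]⟩

theorem Submonoid.exists_mul_mem_of_mem_closure [Monoid R] {S : Submonoid R} {Y : Set R}
    (hS : ∀ s ∈ S, ∀ a, ∃ b, s * a = b * s) (hY : ∀ y ∈ Y, ∃ a, a * y ∈ S) {d : R}
    (hd : d ∈ Submonoid.closure Y) : ∃ a, a * d ∈ S := by
  induction hd using Submonoid.closure_induction with
  | mem y hy => exact hY y hy
  | one => exact ⟨1, by simp⟩
  | mul d e _ _ hd he =>
    obtain ⟨a, ha⟩ := hd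
    obtain ⟨b, hb⟩ := he
    obtain ⟨c, hc⟩ := hS _ ha b
    refine ⟨c * a, ?_⟩
    have h : c * a * (d * e) = (a * d) * (b * e) := by
      rw [← mul_assoc (a * d), hc]
      simp only [mul_assoc]
    exact h ▸ mul_mem ha hb

end Normalizing

theorem stmt_6 {A : Type*} [Ring A] {G : Type*} [Group G]
    (A₀ : Subring A) (u : G → A)
    (hu1 : u 1 = 1) (hune : ∀ g : G, u g ≠ 0)
    (C1span : ∀ a : A, ∃ c : G →₀ A₀, a = c.sum fun g x => (x : A) * u g)
    (C1ind : ∀ c : G →₀ A₀, (c.sum fun g x => (x : A) * u g) = 0 → c = 0)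
    (C2set : ∀ g : G, {x : A | ∃ a₀ : A₀, x = (a₀ : A) * u g} =
        {x : A | ∃ a₀ : A₀, x = u g * (a₀ : A)})
    (C2free : ∀ (g : G) (a₀ : A₀), (a₀ : A) * u g = 0 → a₀ = 0)
    (C3 : ∀ (g h : G) (a₀ b₀ : A₀), ∃ c₀ : A₀,
        ((a₀ : A) * u g) * ((b₀ : A) * u h) = (c₀ : A) * u (g * h))
    (σ : G → A₀ → A₀)
    (hσ : ∀ (g : G) (a₀ : A₀), u g * (a₀ : A) = ((σ g a₀ : A₀) : A) * u g)
    (α : G → G → A₀)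
    (hα : ∀ g h : G, u g * u h = ((α g h : A₀) : A) * u (g * h))
    (h0 : (0 : A₀) ∉ (Submonoid.closure {x : A₀ | ∃ g : G, x = α g g⁻¹} : Submonoid A₀)) :
    (∀ s ∈ (Submonoid.closure {x : A₀ | ∃ g : G, x = α g g⁻¹} : Submonoid A₀), ∀ a₀ : A₀,
        ∃ s' ∈ (Submonoid.closure {x : A₀ | ∃ g : G, x = α g g⁻¹} : Submonoid A₀), ∃ a₀' : A₀, s' * a₀ = a₀' * s) ∧
    (∀ s ∈ (Submonoid.closure {x : A₀ | ∃ g : G, x = α g g⁻¹} : Submonoid A₀), ∀ a₀ : A₀, a₀ * s = 0 →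
        ∃ s' ∈ (Submonoid.closure {x : A₀ | ∃ g : G, x = α g g⁻¹} : Submonoid A₀), s' * a₀ = 0) ∧
    (∀ d ∈ (Submonoid.closure {x : A₀ | ∃ g h : G, x = α g h} : Submonoid A₀),
        ∃ a₀ : A₀, a₀ * d ∈ (Submonoid.closure {x : A₀ | ∃ g : G, x = α g g⁻¹} : Submonoid A₀)) := by
  have cancel : ∀ (g : G) (a b : A₀), (a : A) * u g = b * u g → a = b := fun g a b h =>
    sub_eq_zero.mp (C2free g (a - b) (by rw [AddSubgroupClass.coe_sub, sub_mul, h, sub_self]))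
  have σ_zero : ∀ g, σ g 0 = 0 := fun g => cancel g _ _ (by rw [← hσ]; simp)
  have σ_mul : ∀ g a b, σ g (a * b) = σ g a * σ g b := fun g a b => cancel g _ _ (by
    rw [← hσ, Subring.coe_mul, Subring.coe_mul, ← mul_assoc, hσ, mul_assoc, hσ, mul_assoc])
  have σ_surj : ∀ g, Function.Surjective (σ g) := fun g a => by
    have h : (a : A) * u g ∈ {x : A | ∃ a₀ : A₀, x = u g * (a₀ : A)} := C2set g ▸ ⟨a, rfl⟩
    obtain ⟨b, hb⟩ := h
    exact ⟨b, cancel g _ _ (by rw [← hσ, hb])⟩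
  have α_one_left : ∀ h, α 1 h = 1 := fun h => cancel h _ _ (by
    have := hα 1 h
    rw [hu1, one_mul, one_mul] at this
    rw [← this, Subring.coe_one, one_mul])
  have α_one_right : ∀ g, α g 1 = 1 := fun g => cancel g _ _ (by
    have := hα g 1
    rw [hu1, mul_one, mul_one] at this
    rw [← this, Subring.coe_one, one_mul])
  have cocycle : ∀ g h k, α g h * α (g * h) k = σ g (α h k) * α g (h * k) := fun g h k =>
    cancel (g * h * k) _ _ (by
      rw [Subring.coe_mul, Subring.coe_mul, mul_assoc, ← hα, ← mul_assoc, ← hα, mul_assoc _ _ (u _),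
        mul_assoc g, hα h k, ← mul_assoc, hσ, mul_assoc, hα, mul_assoc])
  have comm : ∀ g a, α g g⁻¹ * a = σ g (σ g⁻¹ a) * α g g⁻¹ := fun g a => cancel 1 _ _ (by
    have h := hα g g⁻¹
    rw [mul_inv_cancel, hu1, mul_one] at h
    rw [hu1, mul_one, mul_one, Subring.coe_mul, Subring.coe_mul, ← h, mul_assoc, hσ, ← mul_assoc,
      hσ, mul_assoc])
  have σ_α_inv : ∀ g, σ g (α g⁻¹ g) = α g g⁻¹ := fun g => by
    simpa [α_one_left, α_one_right] using (cocycle g g⁻¹ g).symm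
  have normal : ∀ s ∈ (Submonoid.closure {x : A₀ | ∃ g : G, x = α g g⁻¹} : Submonoid A₀),
      ∀ a, ∃ b, s * a = b * s := fun s hs a =>
    Submonoid.exists_mul_eq_mul_of_mem_closure
      (by rintro _ ⟨g, rfl⟩ a; exact ⟨_, comm g a⟩) hs a
  refine ⟨fun s hs a => ⟨s, hs, normal s hs a⟩, fun s hs a ha =>
    Submonoid.exists_mul_eq_zero_of_mem_closure ?_ hs a ha, fun d hd =>
    Submonoid.exists_mul_mem_of_mem_closure normal ?_ hd⟩
  · rintro _ ⟨g, rfl⟩ a ha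
    obtain ⟨c, rfl⟩ := σ_surj g a
    obtain ⟨b, rfl⟩ := σ_surj g⁻¹ c
    have hfix : σ g (σ g⁻¹ (α g g⁻¹)) = α g g⁻¹ := by
      have := σ_α_inv g⁻¹
      rw [inv_inv] at this
      rw [this, σ_α_inv]
    rw [← comm] at ha
    have h : σ g (σ g⁻¹ (α g g⁻¹ * b)) = 0 := by rw [ha, σ_zero, σ_zero]
    rwa [σ_mul, σ_mul, hfix] at h
  · rintro _ ⟨g, h, rfl⟩
    refine ⟨σ g (α g⁻¹ (g * h)), Submonoid.subset_closure ⟨g, ?_⟩⟩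
    simpa [α_one_left] using (cocycle g g⁻¹ (g * h)).symm
end

section
/- For every g ∈ G and a_0 ∈ A_0: if a_0·α(g,g⁻¹) = 0, then α(g,g⁻¹)·a_0 = 0. -/
theorem stmt_7 {A : Type*} [Ring A] {G : Type*} [Group G]
    (A₀ : Subring A) (u : G → A)
    (hu1 : u 1 = 1) (hune : ∀ g : G, u g ≠ 0)
    (C1span : ∀ a : A, ∃ c : G →₀ A₀, a = c.sum fun g x => (x : A) * u g)
    (C1ind : ∀ c : G →₀ A₀, (c.sum fun g x => (x : A) * u g) = 0 → c = 0)
    (C2set : ∀ g : G, {x : A | ∃ a₀ : A₀, x = (a₀ : A) * u g} =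
        {x : A | ∃ a₀ : A₀, x = u g * (a₀ : A)})
    (C2free : ∀ (g : G) (a₀ : A₀), (a₀ : A) * u g = 0 → a₀ = 0)
    (C3 : ∀ (g h : G) (a₀ b₀ : A₀), ∃ c₀ : A₀,
        ((a₀ : A) * u g) * ((b₀ : A) * u h) = (c₀ : A) * u (g * h))
    (σ : G → A₀ → A₀)
    (hσ : ∀ (g : G) (a₀ : A₀), u g * (a₀ : A) = ((σ g a₀ : A₀) : A) * u g)
    (α : G → G → A₀)
    (hα : ∀ g h : G, u g * u h = ((α g h : A₀) : A) * u (g * h)) :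
    ∀ (g : G) (a₀ : A₀),
      a₀ * α g g⁻¹ = 0 → α g g⁻¹ * a₀ = 0 := by
  intro g a ha
  have hα_eq : u g * u g⁻¹ = (α g g⁻¹ : A) := by simpa [hu1] using hα g g⁻¹
  have hβ_eq : u g⁻¹ * u g = (α g⁻¹ g : A) := by simpa [hu1] using hα g⁻¹ g
  have ha' : (a : A) * (u g * u g⁻¹) = 0 := by
    rw [hα_eq]
    exact_mod_cast ha
  have hzero : u g⁻¹ * (a : A) * u g = 0 := by
    have hσβ : σ g⁻¹ a * α g⁻¹ g = 0 := by
      apply C2free g⁻¹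
      push_cast
      rw [← hβ_eq, ← mul_assoc, ← hσ, mul_assoc, mul_assoc, ha', mul_zero]
    rw [hσ, mul_assoc, hβ_eq]
    exact_mod_cast hσβ
  apply C2free g
  push_cast
  rw [← hα_eq, mul_assoc, mul_assoc, ← mul_assoc (u g⁻¹), hzero, mul_zero]
end

section
/- Assume 0 ∉ S(G). Then S(G) is a left Ore set in the whole ring A: (i) for every x ∈ A and s ∈ S(G) there exist s' ∈ S(G) and x' ∈ A with s'·x = x'·s; and (ii) if a·s = 0 for some a ∈ A and s ∈ S(G), then s''·a = 0 for some s'' ∈ S(G). -/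
/-- An element `x` is normalizing when the left and right multiples of `x` coincide. -/
def IsNormalizing {R : Type*} [Mul R] (x : R) : Prop :=
  ∀ a : R, (∃ b, x * a = b * x) ∧ ∃ b, a * x = x * b

theorem IsNormalizing.one {R : Type*} [Monoid R] : IsNormalizing (1 : R) :=
  fun a => ⟨⟨a, by simp⟩, ⟨a, by simp⟩⟩

theorem IsNormalizing.mul {R : Type*} [Semigroup R] {x y : R} (hx : IsNormalizing x)
    (hy : IsNormalizing y) : IsNormalizing (x * y) := by
  intro a
  constructor
  · obtain ⟨b, hb⟩ := (hy a).1
    obtain ⟨c, hc⟩ := (hx b).1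
    exact ⟨c, by rw [mul_assoc, hb, ← mul_assoc, hc, mul_assoc]⟩
  · obtain ⟨b, hb⟩ := (hx a).2
    obtain ⟨c, hc⟩ := (hy b).2
    exact ⟨c, by rw [← mul_assoc, hb, mul_assoc, hc, mul_assoc]⟩

/-- Surjective twisting maps `σ` together with a normalized two-cocycle `α` over them. -/
structure IsTwistedSystem {G R : Type*} [Group G] [Ring R] (σ : G → R → R) (α : G → G → R) :
    Prop where
  map_mul : ∀ g a b, σ g (a * b) = σ g a * σ g b
  map_one : ∀ g, σ g 1 = 1
  map_zero : ∀ g, σ g 0 = 0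
  surjective : ∀ g, Function.Surjective (σ g)
  one_apply : ∀ a, σ 1 a = a
  one_left : ∀ g, α 1 g = 1
  one_right : ∀ g, α g 1 = 1
  twist : ∀ g h a, σ g (σ h a) * α g h = α g h * σ (g * h) a
  cocycle : ∀ g h t, α g h * α (g * h) t = σ g (α h t) * α g (h * t)

namespace IsTwistedSystem

variable {G R : Type*} [Group G] [Ring R] {σ : G → R → R} {α : G → G → R}

theorem isNormalizing (H : IsTwistedSystem σ α) (g h : G) : IsNormalizing (α g h) := by
  intro a
  constructor
  · obtain ⟨b, rfl⟩ := H.surjective (g * h) a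
    exact ⟨_, (H.twist g h b).symm⟩
  · obtain ⟨b, rfl⟩ := H.surjective g a
    obtain ⟨c, rfl⟩ := H.surjective h b
    exact ⟨_, H.twist g h c⟩

theorem isNormalizing_map (H : IsTwistedSystem σ α) (g : G) {x : R} (hx : IsNormalizing x) :
    IsNormalizing (σ g x) := by
  intro a
  obtain ⟨b, rfl⟩ := H.surjective g a
  obtain ⟨⟨c, hc⟩, ⟨d, hd⟩⟩ := hx b
  exact ⟨⟨σ g c, by rw [← H.map_mul, hc, H.map_mul]⟩, ⟨σ g d, by rw [← H.map_mul, hd, H.map_mul]⟩⟩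

theorem isNormalizing_of_mem (H : IsTwistedSystem σ α) {s : R}
    (hs : s ∈ Submonoid.closure {x : R | ∃ g : G, x = α g g⁻¹}) : IsNormalizing s := by
  induction hs using Submonoid.closure_induction with
  | mem x hx =>
    obtain ⟨g, rfl⟩ := hx
    exact H.isNormalizing g g⁻¹
  | one => exact .one
  | mul x y _ _ hx hy => exact hx.mul hy

theorem map_inv_left (H : IsTwistedSystem σ α) (g : G) : σ g (α g⁻¹ g) = α g g⁻¹ := by
  simpa [H.one_left, H.one_right] using (H.cocycle g g⁻¹ g).symm

theorem twist_inv (H : IsTwistedSystem σ α) (g : G) (a : R) :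
    σ g (σ g⁻¹ a) * α g g⁻¹ = α g g⁻¹ * a := by
  simpa [H.one_apply] using H.twist g g⁻¹ a

theorem map_map_inv (H : IsTwistedSystem σ α) (g : G) : σ g (σ g⁻¹ (α g g⁻¹)) = α g g⁻¹ := by
  have h := H.map_inv_left g⁻¹
  rw [inv_inv] at h
  rw [h, H.map_inv_left]

/-- The square of `α g g⁻¹` is a left multiple of `α g h`. -/
theorem exists_mul_eq_sq (H : IsTwistedSystem σ α) (g h : G) :
    ∃ b, α g g⁻¹ * α g g⁻¹ = b * α g h := by
  have h1 : α g⁻¹ g = σ g⁻¹ (α g h) * α g⁻¹ (g * h) := by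
    simpa [H.one_left] using H.cocycle g⁻¹ g h
  have h2 : α g g⁻¹ = σ g (σ g⁻¹ (α g h)) * σ g (α g⁻¹ (g * h)) := by
    rw [← H.map_mul, ← h1, H.map_inv_left]
  obtain ⟨z, hz⟩ := (H.isNormalizing g g⁻¹ (σ g (α g⁻¹ (g * h)))).2
  obtain ⟨w, hw⟩ := (H.isNormalizing g h z).1
  refine ⟨α g g⁻¹ * w, ?_⟩
  calc α g g⁻¹ * α g g⁻¹
      = σ g (σ g⁻¹ (α g h)) * (σ g (α g⁻¹ (g * h)) * α g g⁻¹) := by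
        rw [← mul_assoc, ← h2]
    _ = α g g⁻¹ * (α g h * z) := by
        rw [hz, ← mul_assoc, H.twist_inv, mul_assoc]
    _ = α g g⁻¹ * w * α g h := by rw [hw, mul_assoc]

/-- The left multiples of `σ g s` meet the monoid generated by the `α h h⁻¹`. -/
theorem exists_mem_eq_mul_map (H : IsTwistedSystem σ α) (g : G) {s : R}
    (hs : s ∈ Submonoid.closure {x : R | ∃ g : G, x = α g g⁻¹}) :
    ∃ t ∈ Submonoid.closure {x : R | ∃ g : G, x = α g g⁻¹}, ∃ b, t = b * σ g s := by
  have key : ∀ {x y t t' b b' : R}, t ∈ Submonoid.closure {x : R | ∃ g : G, x = α g g⁻¹} →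
      t = b * x → t' = b' * y → ∃ c, t * t' = c * (x * y) := by
    intro x y t t' b b' ht hx hy
    obtain ⟨c, hc⟩ := (H.isNormalizing_of_mem ht b').1
    exact ⟨c * b, by rw [hy, ← mul_assoc, hc, hx]; simp only [mul_assoc]⟩
  induction hs using Submonoid.closure_induction with
  | mem x hx =>
    obtain ⟨h, rfl⟩ := hx
    have hm : ∀ k : G, α k k⁻¹ * α k k⁻¹ ∈
        Submonoid.closure {x : R | ∃ g : G, x = α g g⁻¹} := fun k =>
      mul_mem (Submonoid.subset_closure ⟨k, rfl⟩) (Submonoid.subset_closure ⟨k, rfl⟩)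
    obtain ⟨b, hb⟩ := H.exists_mul_eq_sq g h
    obtain ⟨c, hc⟩ := H.exists_mul_eq_sq (g * h) h⁻¹
    obtain ⟨d, hd⟩ := key (hm g) hb hc
    have h3 : α g h * α (g * h) h⁻¹ = σ g (α h h⁻¹) := by
      simpa [H.one_right] using H.cocycle g h h⁻¹
    exact ⟨_, mul_mem (hm g) (hm (g * h)), d, by rw [hd, h3]⟩
  | one => exact ⟨1, one_mem _, 1, by rw [H.map_one, mul_one]⟩
  | mul x y _ _ hx hy =>
    obtain ⟨t, ht, b, hb⟩ := hx
    obtain ⟨t', ht', b', hb'⟩ := hy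
    obtain ⟨c, hc⟩ := key ht hb hb'
    exact ⟨_, mul_mem ht ht', c, by rw [hc, H.map_mul]⟩

theorem exists_mem_mul_eq_zero (H : IsTwistedSystem σ α) {s : R}
    (hs : s ∈ Submonoid.closure {x : R | ∃ g : G, x = α g g⁻¹}) {a : R} (ha : a * s = 0) :
    ∃ t ∈ Submonoid.closure {x : R | ∃ g : G, x = α g g⁻¹}, t * a = 0 := by
  induction hs using Submonoid.closure_induction generalizing a with
  | mem x hx =>
    obtain ⟨g, rfl⟩ := hx
    refine ⟨_, Submonoid.subset_closure ⟨g, rfl⟩, ?_⟩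
    rw [← H.twist_inv, ← congrArg (_ * ·) (H.map_map_inv g)]
    rw [← H.map_mul, ← H.map_mul, ha, H.map_zero, H.map_zero]
  | one => exact ⟨1, one_mem _, by simpa using ha⟩
  | mul x y _ _ hx hy =>
    rw [← mul_assoc] at ha
    obtain ⟨t, ht, h1⟩ := hy ha
    rw [← mul_assoc] at h1
    obtain ⟨t', ht', h2⟩ := hx h1
    exact ⟨_, mul_mem ht' ht, by rw [mul_assoc, h2]⟩

theorem exists_mem_mul_eq_zero_of_map (H : IsTwistedSystem σ α) (g : G) {s : R}
    (hs : s ∈ Submonoid.closure {x : R | ∃ g : G, x = α g g⁻¹}) {a : R} (ha : a * σ g s = 0) :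
    ∃ t ∈ Submonoid.closure {x : R | ∃ g : G, x = α g g⁻¹}, t * a = 0 := by
  obtain ⟨t, ht, b, hb⟩ := H.exists_mem_eq_mul_map g hs
  obtain ⟨c, hc⟩ := (H.isNormalizing_map g (H.isNormalizing_of_mem hs) b).2
  exact H.exists_mem_mul_eq_zero ht (by rw [hb, hc, ← mul_assoc, ha, zero_mul])

end IsTwistedSystem


theorem stmt_9 {A : Type*} [Ring A] {G : Type*} [Group G]
    (A₀ : Subring A) (u : G → A)
    (hu1 : u 1 = 1) (hune : ∀ g : G, u g ≠ 0)
    (C1span : ∀ a : A, ∃ c : G →₀ A₀, a = c.sum fun g x => (x : A) * u g)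
    (C1ind : ∀ c : G →₀ A₀, (c.sum fun g x => (x : A) * u g) = 0 → c = 0)
    (C2set : ∀ g : G, {x : A | ∃ a₀ : A₀, x = (a₀ : A) * u g} =
        {x : A | ∃ a₀ : A₀, x = u g * (a₀ : A)})
    (C2free : ∀ (g : G) (a₀ : A₀), (a₀ : A) * u g = 0 → a₀ = 0)
    (C3 : ∀ (g h : G) (a₀ b₀ : A₀), ∃ c₀ : A₀,
        ((a₀ : A) * u g) * ((b₀ : A) * u h) = (c₀ : A) * u (g * h))
    (σ : G → A₀ → A₀)
    (hσ : ∀ (g : G) (a₀ : A₀), u g * (a₀ : A) = ((σ g a₀ : A₀) : A) * u g)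
    (α : G → G → A₀)
    (hα : ∀ g h : G, u g * u h = ((α g h : A₀) : A) * u (g * h))
    (h0 : (0 : A₀) ∉ (Submonoid.closure {x : A₀ | ∃ g : G, x = α g g⁻¹} : Submonoid A₀)) :
    (∀ (x : A), ∀ s ∈ (Submonoid.closure {x : A₀ | ∃ g : G, x = α g g⁻¹} : Submonoid A₀),
        ∃ s' ∈ (Submonoid.closure {x : A₀ | ∃ g : G, x = α g g⁻¹} : Submonoid A₀), ∃ x' : A, ((s' : A₀) : A) * x = x' * ((s : A₀) : A)) ∧
    (∀ (a : A), ∀ s ∈ (Submonoid.closure {x : A₀ | ∃ g : G, x = α g g⁻¹} : Submonoid A₀), a * ((s : A₀) : A) = 0 →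
        ∃ s'' ∈ (Submonoid.closure {x : A₀ | ∃ g : G, x = α g g⁻¹} : Submonoid A₀), ((s'' : A₀) : A) * a = 0) := by
  have cancel : ∀ (g : G) (a b : A₀), (a : A) * u g = (b : A) * u g → a = b := fun g a b h =>
    sub_eq_zero.1 (C2free g _ (by push_cast; rw [sub_mul, h, sub_self]))
  have H : IsTwistedSystem σ α :=
    { map_mul := fun g a b => cancel g _ _ (by
        rw [← hσ]; push_cast
        rw [← mul_assoc, hσ, mul_assoc, hσ, mul_assoc])
      map_one := fun g => cancel g _ _ (by rw [← hσ]; simp)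
      map_zero := fun g => cancel g _ _ (by rw [← hσ]; simp)
      surjective := fun g a => by
        have h : (a : A) * u g ∈ {x : A | ∃ a₀ : A₀, x = u g * (a₀ : A)} := by
          rw [← C2set]; exact ⟨a, rfl⟩
        obtain ⟨b, hb⟩ := h
        exact ⟨b, cancel g _ _ (by rw [← hσ, hb])⟩
      one_apply := fun a => cancel 1 _ _ (by rw [← hσ, hu1]; simp)
      one_left := fun g => cancel g _ _ (by
        have h := hα 1 g
        rw [one_mul, hu1] at h
        rw [← h]; simp)
      one_right := fun g => cancel g _ _ (by
        have h := hα g 1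
        rw [mul_one, hu1] at h
        rw [← h]; simp)
      twist := fun g h a => cancel (g * h) _ _ (by
        push_cast
        rw [mul_assoc, ← hα, mul_assoc, ← hσ, ← mul_assoc, ← mul_assoc, ← hα, ← hσ,
          mul_assoc, ← hσ, mul_assoc])
      cocycle := fun g h t => cancel (g * h * t) _ _ (by
        push_cast
        rw [mul_assoc, ← hα, ← mul_assoc, ← hα, mul_assoc _ _ (u (g * h * t)),
          mul_assoc g h t, ← hα, ← mul_assoc, ← hσ, mul_assoc (u g) _ (u (h * t)), ← hα,
          mul_assoc]) }
  have swap : ∀ t ∈ Submonoid.closure {x : A₀ | ∃ g : G, x = α g g⁻¹}, ∀ t' : A₀,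
      ∃ c : A₀, (t : A) * t' = c * t := fun t ht t' => by
    obtain ⟨c, hc⟩ := (H.isNormalizing_of_mem ht t').1
    exact ⟨c, by exact_mod_cast congrArg (Subtype.val) hc⟩
  constructor
  · intro x s hs
    obtain ⟨c, rfl⟩ := C1span x
    induction c using Finsupp.induction_linear with
    | zero => exact ⟨1, one_mem _, 0, by simp⟩
    | add f k hf hk =>
      obtain ⟨t, ht, x, hx⟩ := hf
      obtain ⟨t', ht', y, hy⟩ := hk
      obtain ⟨c, hc⟩ := swap t ht t'
      refine ⟨t * t', mul_mem ht ht', c * x + t * y, ?_⟩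
      rw [Finsupp.sum_add_index' (by simp) (by simp [add_mul]), mul_add, add_mul, mul_assoc,
        ← hx, ← mul_assoc, mul_assoc (t : A) y, ← hy, ← mul_assoc, ← hc]
      push_cast
      rfl
    | single g a =>
      obtain ⟨t, ht, b, hb⟩ := H.exists_mem_eq_mul_map g hs
      obtain ⟨c, hc⟩ := swap t ht a
      refine ⟨t, ht, c * b * u g, ?_⟩
      rw [Finsupp.sum_single_index (by simp), ← mul_assoc, hc, mul_assoc _ (u g), hσ, hb]
      push_cast
      simp only [mul_assoc]
  · intro a s hs has
    obtain ⟨c, rfl⟩ := C1span a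
    have hc : ∀ g, c g * σ g s = 0 := by
      let d : G →₀ A₀ := Finsupp.onFinset c.support (fun g => c g * σ g s) (by
        intro g hg
        rw [Finsupp.mem_support_iff]
        intro h0
        exact hg (by rw [h0, zero_mul]))
      have hd : d = 0 := C1ind d (by
        rw [Finsupp.onFinset_sum _ (by simp), ← has, Finsupp.sum, Finset.sum_mul]
        refine Finset.sum_congr rfl fun g _ => ?_
        rw [mul_assoc (c g : A), hσ]
        push_cast
        rw [mul_assoc])
      exact fun g => DFunLike.congr_fun hd g
    have kill : ∀ F : Finset G, ∃ t ∈ Submonoid.closure {x : A₀ | ∃ g : G, x = α g g⁻¹},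
        ∀ g ∈ F, (t : A) * (c g : A) = 0 := by
      classical
      intro F
      induction F using Finset.induction_on with
      | empty => exact ⟨1, one_mem _, by simp⟩
      | insert g F _ ih =>
        obtain ⟨t, ht, h1⟩ := ih
        obtain ⟨t', ht', h2⟩ := H.exists_mem_mul_eq_zero_of_map g hs (hc g)
        have h3 : (t' : A) * (c g : A) = 0 := by exact_mod_cast congrArg Subtype.val h2
        refine ⟨t * t', mul_mem ht ht', fun k hk => ?_⟩
        push_cast
        rcases Finset.mem_insert.1 hk with rfl | hk
        · rw [mul_assoc, h3, mul_zero]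
        · obtain ⟨d, hd⟩ := swap t ht t'
          rw [hd, mul_assoc, h1 k hk, mul_zero]
    obtain ⟨t, ht, h⟩ := kill c.support
    refine ⟨t, ht, ?_⟩
    rw [Finsupp.sum, Finset.mul_sum]
    exact Finset.sum_eq_zero fun g hg => by rw [← mul_assoc, h g hg, zero_mul]
end

section
/- Assume A_0 is S(G)-torsionfree. Then the following are equivalent: (1) α(g,h) lies in the center Z(A_0) for all g,h ∈ G; (2) σ_g ∘ σ_h = σ_{gh} for all g,h ∈ G (i.e. σ : G → Aut(A_0) is a group homomorphism). -/
theorem stmt_11 {A : Type*} [Ring A] {G : Type*} [Group G]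
    (A₀ : Subring A) (u : G → A)
    (hu1 : u 1 = 1) (hune : ∀ g : G, u g ≠ 0)
    (C1span : ∀ a : A, ∃ c : G →₀ A₀, a = c.sum fun g x => (x : A) * u g)
    (C1ind : ∀ c : G →₀ A₀, (c.sum fun g x => (x : A) * u g) = 0 → c = 0)
    (C2set : ∀ g : G, {x : A | ∃ a₀ : A₀, x = (a₀ : A) * u g} =
        {x : A | ∃ a₀ : A₀, x = u g * (a₀ : A)})
    (C2free : ∀ (g : G) (a₀ : A₀), (a₀ : A) * u g = 0 → a₀ = 0)
    (C3 : ∀ (g h : G) (a₀ b₀ : A₀), ∃ c₀ : A₀,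
        ((a₀ : A) * u g) * ((b₀ : A) * u h) = (c₀ : A) * u (g * h))
    (σ : G → A₀ → A₀)
    (hσ : ∀ (g : G) (a₀ : A₀), u g * (a₀ : A) = ((σ g a₀ : A₀) : A) * u g)
    (α : G → G → A₀)
    (hα : ∀ g h : G, u g * u h = ((α g h : A₀) : A) * u (g * h))
    (htf : ∀ s ∈ (Submonoid.closure {x : A₀ | ∃ g : G, x = α g g⁻¹} : Submonoid A₀), ∀ a₀ : A₀, s * a₀ = 0 → a₀ = 0) :
    (∀ g h : G, ∀ x : A₀, α g h * x = x * α g h) ↔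
    (∀ g h : G, σ g ∘ σ h = σ (g * h)) := by
  have cancel : ∀ (g : G) (x y : A₀), (x : A) * u g = (y : A) * u g → x = y := by
    intro g x y h
    refine sub_eq_zero.mp (C2free g _ ?_)
    rw [AddSubgroupClass.coe_sub, sub_mul, h, sub_self]
  have surj : ∀ g : G, Function.Surjective (σ g) := by
    intro g y
    obtain ⟨x, hx⟩ : (y : A) * u g ∈ {x : A | ∃ a₀ : A₀, x = u g * (a₀ : A)} :=
      C2set g ▸ ⟨y, rfl⟩
    exact ⟨x, cancel g _ _ ((hσ g x).symm.trans hx.symm)⟩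
  have twist : ∀ (g h : G) (x : A₀), σ g (σ h x) * α g h = α g h * σ (g * h) x := by
    intro g h x
    apply cancel (g * h)
    calc ((σ g (σ h x) * α g h : A₀) : A) * u (g * h)
        = (σ g (σ h x) : A) * (u g * u h) := by rw [hα, Subring.coe_mul, mul_assoc]
      _ = u g * (u h * (x : A)) := by rw [hσ h, ← mul_assoc, ← mul_assoc, hσ g]
      _ = ((α g h * σ (g * h) x : A₀) : A) * u (g * h) := by
        rw [← mul_assoc, hα, mul_assoc, hσ, Subring.coe_mul, mul_assoc]
  have inv_torsion : ∀ (g : G) (a : A₀), α g g⁻¹ * a = 0 → a = 0 := fun g =>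
    htf _ (Submonoid.subset_closure ⟨g, rfl⟩)
  have u_mul_u_inv : ∀ g : G, u g * u g⁻¹ = (α g g⁻¹ : A) := by
    intro g
    rw [hα, mul_inv_cancel, hu1, mul_one]
  have u_regular : ∀ (g : G) (b : A₀), u g * (b : A) = 0 → b = 0 := by
    intro g b hb
    apply inv_torsion g⁻¹
    apply Subtype.ext
    rw [Subring.coe_mul, ← u_mul_u_inv, inv_inv, mul_assoc, hb, mul_zero, Subring.coe_zero]
  constructor
  · intro hc g h
    funext x
    refine sub_eq_zero.mp ?_
    have hz : α g h * (σ g (σ h x) - σ (g * h) x) = 0 := by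
      rw [mul_sub, hc, twist, sub_self]
    change σ g (σ h x) - σ (g * h) x = 0
    obtain ⟨b, hb⟩ := surj g (σ g (σ h x) - σ (g * h) x)
    rw [← hb] at hz ⊢
    have hprod : α g h * α (g * h) h⁻¹ * σ g b = 0 := by
      rw [hc g h, mul_assoc, hz, mul_zero]
    have hb0 : b = 0 := by
      apply inv_torsion h
      apply u_regular g
      calc u g * ((α h h⁻¹ * b : A₀) : A)
          = u g * u h * u h⁻¹ * (b : A) := by
            rw [Subring.coe_mul, ← u_mul_u_inv]; simp only [mul_assoc]
        _ = ((α g h * α (g * h) h⁻¹ * σ g b : A₀) : A) * u g := by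
            rw [hα g h, mul_assoc (α g h : A), hα, mul_inv_cancel_right]
            simp only [Subring.coe_mul, mul_assoc, hσ]
        _ = 0 := by rw [hprod, Subring.coe_zero, zero_mul]
    apply C2free g
    rw [← hσ, hb0, Subring.coe_zero, mul_zero]
  · intro hcomp g h x
    obtain ⟨y, rfl⟩ := surj (g * h) x
    rw [← twist, ← hcomp, Function.comp_apply]
end

section
/- Assume A_0 is S(G)-torsionfree. Then for every g ∈ G the following are equivalent: (1) α(g⁻¹,g) lies in the center Z(A_0); (2) σ_g ∘ σ_{g⁻¹} = σ_{g⁻¹} ∘ σ_g = id on A_0. -/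
theorem stmt_12 {A : Type*} [Ring A] {G : Type*} [Group G]
    (A₀ : Subring A) (u : G → A)
    (hu1 : u 1 = 1) (hune : ∀ g : G, u g ≠ 0)
    (C1span : ∀ a : A, ∃ c : G →₀ A₀, a = c.sum fun g x => (x : A) * u g)
    (C1ind : ∀ c : G →₀ A₀, (c.sum fun g x => (x : A) * u g) = 0 → c = 0)
    (C2set : ∀ g : G, {x : A | ∃ a₀ : A₀, x = (a₀ : A) * u g} =
        {x : A | ∃ a₀ : A₀, x = u g * (a₀ : A)})
    (C2free : ∀ (g : G) (a₀ : A₀), (a₀ : A) * u g = 0 → a₀ = 0)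
    (C3 : ∀ (g h : G) (a₀ b₀ : A₀), ∃ c₀ : A₀,
        ((a₀ : A) * u g) * ((b₀ : A) * u h) = (c₀ : A) * u (g * h))
    (σ : G → A₀ → A₀)
    (hσ : ∀ (g : G) (a₀ : A₀), u g * (a₀ : A) = ((σ g a₀ : A₀) : A) * u g)
    (α : G → G → A₀)
    (hα : ∀ g h : G, u g * u h = ((α g h : A₀) : A) * u (g * h))
    (htf : ∀ s ∈ (Submonoid.closure {x : A₀ | ∃ g : G, x = α g g⁻¹} : Submonoid A₀), ∀ a₀ : A₀, s * a₀ = 0 → a₀ = 0) :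
    ∀ g : G,
      (∀ x : A₀, α g⁻¹ g * x = x * α g⁻¹ g) ↔
      (σ g ∘ σ g⁻¹ = id ∧ σ g⁻¹ ∘ σ g = id) := by
  have twist : ∀ (g : G) (x : A₀), σ g⁻¹ (σ g x) * α g⁻¹ g = α g⁻¹ g * x := by
    intro g x
    have hα' : u g⁻¹ * u g = (α g⁻¹ g : A) := by
      rw [hα, inv_mul_cancel, hu1, mul_one]
    apply Subtype.ext
    push_cast
    rw [← hα', ← mul_assoc, ← hσ, mul_assoc, ← hσ, mul_assoc]
  have surj : ∀ g : G, Function.Surjective (σ g) := by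
    intro g a
    have hmem : (a : A) * u g ∈ {x : A | ∃ a₀ : A₀, x = u g * (a₀ : A)} := by
      rw [← C2set g]
      exact ⟨a, rfl⟩
    obtain ⟨b, hb⟩ := hmem
    refine ⟨b, (sub_eq_zero.mp (C2free g (a - σ g b) ?_)).symm⟩
    push_cast
    rw [sub_mul, hb, hσ, sub_self]
  intro g
  constructor
  · intro hc
    have hleft : Function.LeftInverse (σ g⁻¹) (σ g) := by
      intro x
      refine sub_eq_zero.mp (htf (α g⁻¹ g) (Submonoid.subset_closure ⟨g⁻¹, ?_⟩) _ ?_)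
      · rw [inv_inv]
      · rw [mul_sub, hc, twist, sub_self]
    exact ⟨(hleft.rightInverse_of_surjective (surj g)).comp_eq_id, hleft.comp_eq_id⟩
  · rintro ⟨-, h⟩ x
    rw [← twist, ← Function.comp_apply (f := σ g⁻¹), h, id]
end

section
/- Assume 0 ∉ S(G). Then: (i) J is invariant under every σ_g, i.e. σ_g(J) ⊆ J for all g ∈ G; and (ii) the S(G)-torsion set T of A coincides with the additive subgroup of A generated by the products {j·a : j ∈ J, a ∈ A} and also with the additive subgroup generated by {a·j : a ∈ A, j ∈ J}; in short t_{S(G)}(A) = J·A = A·J. -/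
/-- The twisted commutation and multiplication rules of a homogeneous basis `u` over the subring
`A₀`, with twisting maps `σ` and cocycle `α`. -/
structure IsTwistedBasis {A : Type*} [Ring A] {G : Type*} [Group G] (A₀ : Subring A) (u : G → A)
    (σ : G → A₀ → A₀) (α : G → G → A₀) : Prop where
  one : u 1 = 1
  free : ∀ (g : G) (a : A₀), (a : A) * u g = 0 → a = 0
  surj : ∀ g : G, Function.Surjective (σ g)
  comm : ∀ (g : G) (a : A₀), u g * (a : A) = (σ g a : A) * u g
  mul : ∀ g h : G, u g * u h = (α g h : A) * u (g * h)

/-- The monoid generated by the values `α g g⁻¹`. -/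
abbrev cocycleMonoid {R : Type*} [Monoid R] {G : Type*} [Group G] (α : G → G → R) :
    Submonoid R :=
  Submonoid.closure {x | ∃ g, x = α g g⁻¹}

theorem mem_cocycleMonoid {R : Type*} [Monoid R] {G : Type*} [Group G] (α : G → G → R) (g : G) :
    α g g⁻¹ ∈ cocycleMonoid α :=
  Submonoid.subset_closure ⟨g, rfl⟩

namespace IsTwistedBasis

variable {A : Type*} [Ring A] {G : Type*} [Group G] {A₀ : Subring A} {u : G → A}
  {σ : G → A₀ → A₀} {α : G → G → A₀}

theorem cancel (H : IsTwistedBasis A₀ u σ α) {g : G} {a b : A₀}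
    (h : (a : A) * u g = (b : A) * u g) : a = b := by
  refine sub_eq_zero.mp (H.free g _ ?_)
  rw [AddSubgroupClass.coe_sub, sub_mul, h, sub_self]

theorem map_zero (H : IsTwistedBasis A₀ u σ α) (g : G) : σ g 0 = 0 :=
  H.free g _ (by rw [← H.comm]; simp)

theorem map_one (H : IsTwistedBasis A₀ u σ α) (g : G) : σ g 1 = 1 :=
  H.cancel (g := g) (by rw [← H.comm]; simp)

theorem map_mul (H : IsTwistedBasis A₀ u σ α) (g : G) (a b : A₀) :
    σ g (a * b) = σ g a * σ g b :=
  H.cancel (g := g) (by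
    rw [← H.comm, Subring.coe_mul, Subring.coe_mul, mul_assoc, ← H.comm, ← mul_assoc,
      ← mul_assoc, ← H.comm])

theorem mul_inv (H : IsTwistedBasis A₀ u σ α) (g : G) : u g * u g⁻¹ = (α g g⁻¹ : A) := by
  rw [H.mul, mul_inv_cancel, H.one, mul_one]

/-- `α g h` is a normal element. -/
theorem cocycle_mul_map (H : IsTwistedBasis A₀ u σ α) (g h : G) (a : A₀) :
    α g h * σ (g * h) a = σ g (σ h a) * α g h := by
  refine H.cancel (g := g * h) ?_
  calc _ = (α g h : A) * ((σ (g * h) a : A) * u (g * h)) := by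
        rw [Subring.coe_mul, mul_assoc]
    _ = u g * (u h * a) := by rw [← H.comm, ← mul_assoc, ← H.mul, mul_assoc]
    _ = _ := by
        rw [H.comm, ← mul_assoc, H.comm, mul_assoc, H.mul, Subring.coe_mul, mul_assoc]

theorem exists_cocycle_mul (H : IsTwistedBasis A₀ u σ α) (g h : G) (x : A₀) :
    ∃ y, α g h * x = y * α g h := by
  obtain ⟨a, rfl⟩ := H.surj (g * h) x
  exact ⟨_, H.cocycle_mul_map g h a⟩

theorem exists_mul_comm (H : IsTwistedBasis A₀ u σ α) {s : A₀} (hs : s ∈ cocycleMonoid α)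
    (x : A₀) : ∃ y, s * x = y * s := by
  induction hs using Submonoid.closure_induction generalizing x with
  | mem s hs => obtain ⟨g, rfl⟩ := hs; exact H.exists_cocycle_mul g _ x
  | one => exact ⟨x, by simp⟩
  | mul s t _ _ ihs iht =>
    obtain ⟨y, hy⟩ := iht x
    obtain ⟨z, hz⟩ := ihs y
    exact ⟨z, by rw [mul_assoc, hy, ← mul_assoc, hz, mul_assoc]⟩

/-- `α g h` divides `α g g⁻¹`. -/
theorem cocycle_inv_eq (H : IsTwistedBasis A₀ u σ α) (g h : G) :
    α g g⁻¹ = σ g (α g⁻¹ (g * h)) * α g h := by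
  refine H.cancel (g := g * h) ?_
  calc _ = u g * (u g⁻¹ * u (g * h)) := by rw [← H.mul_inv, mul_assoc]
    _ = u g * ((α g⁻¹ (g * h) : A) * u h) := by rw [H.mul, inv_mul_cancel_left]
    _ = _ := by
        rw [← mul_assoc, H.comm, mul_assoc, H.mul, Subring.coe_mul, mul_assoc]

theorem map_cocycle_inv (H : IsTwistedBasis A₀ u σ α) (g h : G) :
    σ g (α h h⁻¹) = α g h * α (g * h) h⁻¹ := by
  refine H.cancel (g := g) ?_
  calc _ = u g * u h * u h⁻¹ := by rw [← H.comm, ← H.mul_inv, mul_assoc]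
    _ = (α g h : A) * ((α (g * h) h⁻¹ : A) * u (g * h * h⁻¹)) := by
        rw [H.mul, mul_assoc, H.mul]
    _ = _ := by rw [mul_inv_cancel_right, Subring.coe_mul, mul_assoc]

theorem exists_mul_map_mem (H : IsTwistedBasis A₀ u σ α) (g : G) {s : A₀}
    (hs : s ∈ cocycleMonoid α) : ∃ x, x * σ g s ∈ cocycleMonoid α := by
  induction hs using Submonoid.closure_induction with
  | mem s hs =>
    obtain ⟨h, rfl⟩ := hs
    obtain ⟨y, hy⟩ := H.exists_cocycle_mul g h (σ (g * h) (α (g * h)⁻¹ (g * h * h⁻¹)))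
    refine ⟨σ g (α g⁻¹ (g * h)) * y, ?_⟩
    have key : σ g (α g⁻¹ (g * h)) * y * σ g (α h h⁻¹) =
        α g g⁻¹ * α (g * h) (g * h)⁻¹ := by
      rw [H.map_cocycle_inv, H.cocycle_inv_eq g h, H.cocycle_inv_eq (g * h) h⁻¹]
      calc _ = σ g (α g⁻¹ (g * h)) * (y * α g h) * α (g * h) h⁻¹ := by
            simp only [mul_assoc]
        _ = _ := by rw [← hy]; simp only [mul_assoc]
    rw [key]
    exact mul_mem (mem_cocycleMonoid α g) (mem_cocycleMonoid α (g * h))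
  | one => exact ⟨1, by rw [H.map_one, mul_one]; exact one_mem _⟩
  | mul s t hs _ ihs iht =>
    obtain ⟨x, hx⟩ := ihs
    obtain ⟨y, hy⟩ := iht
    obtain ⟨y', rfl⟩ := H.surj g y
    obtain ⟨z, hz⟩ := H.exists_mul_comm hs y'
    refine ⟨x * σ g z, ?_⟩
    have key : x * σ g z * σ g (s * t) = x * σ g s * (σ g y' * σ g t) := by
      simp only [← H.map_mul, mul_assoc]
      rw [← mul_assoc z, ← hz, mul_assoc]
    rw [key]
    exact mul_mem hx hy

theorem map_torsion (H : IsTwistedBasis A₀ u σ α) (g : G) {a : A₀}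
    (ha : ∃ s ∈ cocycleMonoid α, s * a = 0) : ∃ s ∈ cocycleMonoid α, s * σ g a = 0 := by
  obtain ⟨s, hs, hsa⟩ := ha
  obtain ⟨x, hx⟩ := H.exists_mul_map_mem g hs
  exact ⟨_, hx, by rw [mul_assoc, ← H.map_mul, hsa, H.map_zero, mul_zero]⟩

theorem torsion_of_map (H : IsTwistedBasis A₀ u σ α) (g : G) {a : A₀}
    (ha : ∃ s ∈ cocycleMonoid α, s * σ g a = 0) : ∃ s ∈ cocycleMonoid α, s * a = 0 := by
  obtain ⟨s, hs, hsa⟩ := H.map_torsion g⁻¹ ha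
  refine ⟨s * α g⁻¹ g⁻¹⁻¹, mul_mem hs (mem_cocycleMonoid α _), ?_⟩
  obtain ⟨b, hb⟩ := H.surj (g⁻¹ * g⁻¹⁻¹) a
  have hba : b = a := by
    rw [← hb]
    refine H.cancel (g := g⁻¹ * g⁻¹⁻¹) ?_
    rw [← H.comm, mul_inv_cancel, H.one, one_mul, mul_one]
  have h := H.cocycle_mul_map g⁻¹ g⁻¹⁻¹ b
  rw [hb, hba] at h
  rw [mul_assoc, h, inv_inv, ← mul_assoc, hsa, zero_mul]

/-- The torsion of `A` with respect to the cocycle monoid, as an additive subgroup. -/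
def torsion (H : IsTwistedBasis A₀ u σ α) : AddSubgroup A where
  carrier := {a | ∃ s ∈ cocycleMonoid α, (s : A) * a = 0}
  zero_mem' := ⟨1, one_mem _, mul_zero _⟩
  neg_mem' := by
    rintro a ⟨s, hs, hsa⟩
    exact ⟨s, hs, by rw [mul_neg, hsa, neg_zero]⟩
  add_mem' := by
    rintro a b ⟨s, hs, hsa⟩ ⟨t, ht, htb⟩
    obtain ⟨y, hy⟩ := H.exists_mul_comm hs t
    refine ⟨s * t, mul_mem hs ht, ?_⟩
    have hsta : ((s * t : A₀) : A) * a = 0 := by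
      rw [hy, Subring.coe_mul, mul_assoc, hsa, mul_zero]
    rw [mul_add, hsta, Subring.coe_mul, mul_assoc, htb, mul_zero, add_zero]

theorem coe_torsion (H : IsTwistedBasis A₀ u σ α) :
    (H.torsion : Set A) = {a | ∃ s ∈ cocycleMonoid α, (s : A) * a = 0} :=
  rfl

theorem mul_mem_torsion (H : IsTwistedBasis A₀ u σ α) {j : A₀}
    (hj : ∃ s ∈ cocycleMonoid α, s * j = 0) (a : A) : (j : A) * a ∈ H.torsion := by
  obtain ⟨s, hs, hsj⟩ := hj
  exact ⟨s, hs, by rw [← mul_assoc, ← Subring.coe_mul, hsj, Subring.coe_zero, zero_mul]⟩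

theorem coe_mul_mem_torsion (H : IsTwistedBasis A₀ u σ α) (x : A₀) {a : A}
    (ha : a ∈ H.torsion) : (x : A) * a ∈ H.torsion := by
  obtain ⟨s, hs, hsa⟩ := ha
  obtain ⟨y, hy⟩ := H.exists_mul_comm hs x
  exact ⟨s, hs, by
    rw [← mul_assoc, ← Subring.coe_mul, hy, Subring.coe_mul, mul_assoc, hsa, mul_zero]⟩

theorem mul_coe_mem_torsion (H : IsTwistedBasis A₀ u σ α)
    (hspan : ∀ a : A, ∃ c : G →₀ A₀, a = c.sum fun g x => (x : A) * u g) {j : A₀}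
    (hj : ∃ s ∈ cocycleMonoid α, s * j = 0) (a : A) : a * (j : A) ∈ H.torsion := by
  obtain ⟨c, rfl⟩ := hspan a
  rw [Finsupp.sum, Finset.sum_mul]
  refine sum_mem fun g _ => ?_
  rw [mul_assoc, H.comm]
  exact H.coe_mul_mem_torsion _ (H.mul_mem_torsion (H.map_torsion g hj) _)

/-- The coefficients of a torsion element are torsion. -/
theorem exists_eq_sum_of_mem_torsion (H : IsTwistedBasis A₀ u σ α)
    (hspan : ∀ a : A, ∃ c : G →₀ A₀, a = c.sum fun g x => (x : A) * u g)
    (hind : ∀ c : G →₀ A₀, (c.sum fun g x => (x : A) * u g) = 0 → c = 0)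
    {a : A} (ha : a ∈ H.torsion) :
    ∃ c : G →₀ A₀, (∀ g, ∃ s ∈ cocycleMonoid α, s * c g = 0) ∧
      a = ∑ g ∈ c.support, (c g : A) * u g := by
  obtain ⟨s, hs, hsa⟩ := ha
  obtain ⟨c, rfl⟩ := hspan a
  refine ⟨c, fun g => ⟨s, hs, ?_⟩, rfl⟩
  have h0 : c.mapRange (s * ·) (mul_zero s) = 0 := by
    refine hind _ ?_
    rw [Finsupp.sum_mapRange_index (by simp), ← hsa, Finsupp.mul_sum]
    simp only [Subring.coe_mul, mul_assoc]
  simpa using DFunLike.congr_fun h0 g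

end IsTwistedBasis

theorem stmt_13 {A : Type*} [Ring A] {G : Type*} [Group G]
    (A₀ : Subring A) (u : G → A)
    (hu1 : u 1 = 1) (hune : ∀ g : G, u g ≠ 0)
    (C1span : ∀ a : A, ∃ c : G →₀ A₀, a = c.sum fun g x => (x : A) * u g)
    (C1ind : ∀ c : G →₀ A₀, (c.sum fun g x => (x : A) * u g) = 0 → c = 0)
    (C2set : ∀ g : G, {x : A | ∃ a₀ : A₀, x = (a₀ : A) * u g} =
        {x : A | ∃ a₀ : A₀, x = u g * (a₀ : A)})
    (C2free : ∀ (g : G) (a₀ : A₀), (a₀ : A) * u g = 0 → a₀ = 0)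
    (C3 : ∀ (g h : G) (a₀ b₀ : A₀), ∃ c₀ : A₀,
        ((a₀ : A) * u g) * ((b₀ : A) * u h) = (c₀ : A) * u (g * h))
    (σ : G → A₀ → A₀)
    (hσ : ∀ (g : G) (a₀ : A₀), u g * (a₀ : A) = ((σ g a₀ : A₀) : A) * u g)
    (α : G → G → A₀)
    (hα : ∀ g h : G, u g * u h = ((α g h : A₀) : A) * u (g * h))
    (h0 : (0 : A₀) ∉ (Submonoid.closure {x : A₀ | ∃ g : G, x = α g g⁻¹} : Submonoid A₀)) :
    (∀ (g : G) (a₀ : A₀), (∃ s ∈ (Submonoid.closure {x : A₀ | ∃ g : G, x = α g g⁻¹} : Submonoid A₀), s * a₀ = 0) →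
        ∃ s ∈ (Submonoid.closure {x : A₀ | ∃ g : G, x = α g g⁻¹} : Submonoid A₀), s * σ g a₀ = 0) ∧
    {a : A | ∃ s ∈ (Submonoid.closure {x : A₀ | ∃ g : G, x = α g g⁻¹} : Submonoid A₀), ((s : A₀) : A) * a = 0} =
      (AddSubgroup.closure {x : A | ∃ j : A₀,
        (∃ s ∈ (Submonoid.closure {x : A₀ | ∃ g : G, x = α g g⁻¹} : Submonoid A₀), s * j = 0) ∧ ∃ a : A, x = (j : A) * a} : AddSubgroup A) ∧
    {a : A | ∃ s ∈ (Submonoid.closure {x : A₀ | ∃ g : G, x = α g g⁻¹} : Submonoid A₀), ((s : A₀) : A) * a = 0} =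
      (AddSubgroup.closure {x : A | ∃ j : A₀,
        (∃ s ∈ (Submonoid.closure {x : A₀ | ∃ g : G, x = α g g⁻¹} : Submonoid A₀), s * j = 0) ∧ ∃ a : A, x = a * (j : A)} : AddSubgroup A) := by
  have H : IsTwistedBasis A₀ u σ α := by
    refine ⟨hu1, C2free, fun g x => ?_, hσ, hα⟩
    obtain ⟨a, ha⟩ := (C2set g).subset ⟨x, rfl⟩
    refine ⟨a, sub_eq_zero.mp (C2free g _ ?_)⟩
    rw [AddSubgroupClass.coe_sub, sub_mul, ← hσ, ← ha, sub_self]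
  refine ⟨fun g a₀ => H.map_torsion g, ?_, ?_⟩ <;> rw [← H.coe_torsion, SetLike.coe_set_eq] <;>
    refine le_antisymm (fun a ha => ?_) ((AddSubgroup.closure_le _).mpr ?_)
  · obtain ⟨c, hc, rfl⟩ := H.exists_eq_sum_of_mem_torsion C1span C1ind ha
    exact sum_mem fun g _ => AddSubgroup.subset_closure ⟨c g, hc g, u g, rfl⟩
  · rintro _ ⟨j, hj, a, rfl⟩
    exact H.mul_mem_torsion hj a
  · obtain ⟨c, hc, rfl⟩ := H.exists_eq_sum_of_mem_torsion C1span C1ind ha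
    refine sum_mem fun g _ => AddSubgroup.subset_closure ?_
    obtain ⟨b, hb⟩ := H.surj g (c g)
    exact ⟨b, H.torsion_of_map g (hb ▸ hc g), u g, by rw [← hb, hσ]⟩
  · rintro _ ⟨j, hj, a, rfl⟩
    exact H.mul_coe_mem_torsion C1span hj a
end

section
/- Let x, y, t be the ℂ-linear endomorphisms of the polynomial ring ℂ[X] given by x(f) = X·f, y(f) = df/dX, and t = x ∘ y. Then for every natural number n ≥ 0 one has the identity of linear endomorphisms xⁿ ∘ yⁿ = (t − (n−1))·(t − (n−2))·…·(t − 1)·t = ∏_{i=0}^{n-1} (t − i·id). -/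
/-- In a ring with `y * x = x * y + 1`, moving `y ^ n` past `x * y`. -/
theorem pow_mul_mul_of_weyl_relation {A : Type*} [Ring A] {x y : A}
    (h : y * x = x * y + 1) (n : ℕ) :
    y ^ n * (x * y) = x * y ^ (n + 1) + (n : A) * y ^ n := by
  induction n with
  | zero => simp
  | succ n ih =>
    calc y ^ (n + 1) * (x * y) = y * (y ^ n * (x * y)) := by rw [pow_succ', mul_assoc]
      _ = y * x * y ^ (n + 1) + (n : A) * (y * y ^ n) := by
        rw [ih, mul_add, ← mul_assoc, ← mul_assoc, ← (Nat.cast_commute n y).eq, mul_assoc (n : A)]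
      _ = x * y ^ (n + 1 + 1) + ((n + 1 : ℕ) : A) * y ^ (n + 1) := by
        rw [h, ← pow_succ', add_mul, mul_assoc x, ← pow_succ']
        push_cast
        noncomm_ring

/-- In a ring with `y * x = x * y + 1`, the element `x ^ n * y ^ n` is the falling factorial
of `x * y`. -/
theorem pow_mul_pow_eq_prod_of_weyl_relation {A : Type*} [Ring A] {x y : A}
    (h : y * x = x * y + 1) (n : ℕ) :
    x ^ n * y ^ n = ((List.range n).map fun i : ℕ => x * y - (i : A)).prod := by
  induction n with
  | zero => simp
  | succ n ih =>
    rw [List.range_succ, List.map_append, List.prod_append, ← ih, List.map_singleton,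
      List.prod_singleton, mul_sub, mul_assoc (x ^ n), pow_mul_mul_of_weyl_relation h, mul_add,
      mul_assoc (x ^ n), (Nat.cast_commute n (y ^ n)).eq, add_sub_cancel_right, ← mul_assoc,
      ← pow_succ]

theorem derivative_mul_mulLeft_X {R : Type*} [CommRing R] :
    (Polynomial.derivative : Module.End R (Polynomial R)) *
        LinearMap.mulLeft R (Polynomial.X : Polynomial R) =
      LinearMap.mulLeft R (Polynomial.X : Polynomial R) *
        (Polynomial.derivative : Module.End R (Polynomial R)) + 1 := by
  refine LinearMap.ext fun f => ?_
  simp [Module.End.mul_apply, Polynomial.derivative_mul, add_comm]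

theorem stmt_16 :
    ∀ n : ℕ,
      (LinearMap.mulLeft ℂ (Polynomial.X : Polynomial ℂ)) ^ n *
          (Polynomial.derivative : Polynomial ℂ →ₗ[ℂ] Polynomial ℂ) ^ n =
        ((List.range n).map (fun i =>
          LinearMap.mulLeft ℂ (Polynomial.X : Polynomial ℂ) *
              (Polynomial.derivative : Polynomial ℂ →ₗ[ℂ] Polynomial ℂ) -
            (i : ℂ) • 1)).prod := by
  intro n
  have hcast (i : ℕ) : (i : ℂ) • (1 : Module.End ℂ (Polynomial ℂ)) = (i : Module.End ℂ _) := by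
    rw [Nat.cast_smul_eq_nsmul, nsmul_one]
  rw [bind_pure_comp, List.map_eq_map, List.map_map]
  simp only [Function.comp_def, hcast]
  exact pow_mul_pow_eq_prod_of_weyl_relation derivative_mul_mulLeft_X n
end

section
/- Let K be a field, λ ∈ K with λ ≠ 0 and λ ≠ 1, and c, d ∈ K with c ≠ d. In the polynomial ring K[T] set p = (c − T)·(d + T) and q = (c − λT)·(d + λT). Then the K-subalgebra of K[T] generated by p and q is all of K[T] (indeed q − λ²·p = (1−λ)λ(c−d)·T + (1−λ²)cd is a polynomial of degree one, so T lies in the subalgebra generated by p and q). -/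
theorem stmt_18 {K : Type*} [Field K] (l c d : K)
    (hl0 : l ≠ 0) (hl1 : l ≠ 1) (hcd : c ≠ d) :
    (Polynomial.C c - Polynomial.C l * Polynomial.X) *
          (Polynomial.C d + Polynomial.C l * Polynomial.X) -
        Polynomial.C (l ^ 2) *
          ((Polynomial.C c - Polynomial.X) * (Polynomial.C d + Polynomial.X)) =
      Polynomial.C ((1 - l) * l * (c - d)) * Polynomial.X +
        Polynomial.C ((1 - l ^ 2) * (c * d)) ∧
    Algebra.adjoin K
        ({(Polynomial.C c - Polynomial.X) * (Polynomial.C d + Polynomial.X),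
          (Polynomial.C c - Polynomial.C l * Polynomial.X) *
            (Polynomial.C d + Polynomial.C l * Polynomial.X)} :
          Set (Polynomial K)) = ⊤ := by
  have hid : (Polynomial.C c - Polynomial.C l * Polynomial.X) *
          (Polynomial.C d + Polynomial.C l * Polynomial.X) -
        Polynomial.C (l ^ 2) *
          ((Polynomial.C c - Polynomial.X) * (Polynomial.C d + Polynomial.X)) =
      Polynomial.C ((1 - l) * l * (c - d)) * Polynomial.X +
        Polynomial.C ((1 - l ^ 2) * (c * d)) := by
    simp only [map_mul, map_sub, map_pow, map_one]
    ring
  refine ⟨hid, ?_⟩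
  have hm : (1 - l) * l * (c - d) ≠ 0 :=
    mul_ne_zero (mul_ne_zero (sub_ne_zero.2 hl1.symm) hl0) (sub_ne_zero.2 hcd)
  rw [← top_le_iff, ← Polynomial.adjoin_X, Algebra.adjoin_le_iff, Set.singleton_subset_iff,
    SetLike.mem_coe]
  set S := Algebra.adjoin K
        ({(Polynomial.C c - Polynomial.X) * (Polynomial.C d + Polynomial.X),
          (Polynomial.C c - Polynomial.C l * Polynomial.X) *
            (Polynomial.C d + Polynomial.C l * Polynomial.X)} :
          Set (Polynomial K))
  have hC (a : K) : Polynomial.C a ∈ S := S.algebraMap_mem a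
  have hp : (Polynomial.C c - Polynomial.X) * (Polynomial.C d + Polynomial.X) ∈ S :=
    Algebra.subset_adjoin (Set.mem_insert _ _)
  have hq : (Polynomial.C c - Polynomial.C l * Polynomial.X) *
      (Polynomial.C d + Polynomial.C l * Polynomial.X) ∈ S :=
    Algebra.subset_adjoin (Set.mem_insert_of_mem _ rfl)
  have hlin := S.sub_mem hq (S.mul_mem (hC (l ^ 2)) hp)
  rw [hid] at hlin
  have hX := S.mul_mem (hC ((1 - l) * l * (c - d))⁻¹)
    (S.sub_mem hlin (hC ((1 - l ^ 2) * (c * d))))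
  rwa [add_sub_cancel_right, ← mul_assoc, ← Polynomial.C_mul, inv_mul_cancel₀ hm,
    Polynomial.C_1, one_mul] at hX
end

section
/- Let R be a commutative ring, σ a ring automorphism of R, and p ∈ R. Define α : ℤ × ℤ → R by: α(n,m) = σⁿ(p) if n ≠ 0, m ≠ 0 and m ≠ −n; α(n,−n) = p·σⁿ(p) if n ≠ 0; and α(0,m) = α(n,0) = 1 for all n, m ∈ ℤ. Then α satisfies the cocycle identity α(n,m)·α(n+m,k) = σⁿ(α(m,k))·α(n,m+k) for all n, m, k ∈ ℤ. -/
theorem stmt_19 {R : Type*} [CommRing R] (σ : R ≃+* R) (p : R)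
    (α : ℤ → ℤ → R)
    (hα1 : ∀ n m : ℤ, n ≠ 0 → m ≠ 0 → m ≠ -n → α n m = (σ ^ n) p)
    (hα2 : ∀ n : ℤ, n ≠ 0 → α n (-n) = p * (σ ^ n) p)
    (hα3 : ∀ m : ℤ, α 0 m = 1) (hα4 : ∀ n : ℤ, α n 0 = 1) :
    ∀ n m k : ℤ,
      α n m * α (n + m) k = (σ ^ n) (α m k) * α n (m + k) := by
  have hσ : ∀ n m : ℤ, (σ ^ n) ((σ ^ m) p) = (σ ^ (n + m)) p := fun n m => by
    rw [zpow_add]; rfl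
  have hσ0 : (σ ^ (0 : ℤ)) p = p := by rw [zpow_zero]; rfl
  intro n m k
  rcases eq_or_ne n 0 with rfl | hn
  · simp [hα3]
  rcases eq_or_ne m 0 with rfl | hm
  · simp [hα3, hα4]
  rcases eq_or_ne k 0 with rfl | hk
  · simp [hα4]
  rcases eq_or_ne m (-n) with rfl | hnm
  · rw [hα2 n hn, add_neg_cancel, hα3]
    rcases eq_or_ne k n with rfl | hkn
    · have h := hα2 (-k) hm
      rw [neg_neg] at h
      rw [h, neg_add_cancel, hα4, map_mul, hσ, add_neg_cancel, hσ0]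
      ring
    · rw [hα1 (-n) k hm hk (by omega), hα1 n (-n + k) hn (by omega) (by omega), hσ,
        add_neg_cancel, hσ0]
      ring
  have hs : n + m ≠ 0 := by omega
  rw [hα1 n m hn hm hnm]
  rcases eq_or_ne k (-m) with rfl | hmk
  · rw [hα2 m hm, add_neg_cancel, hα4, hα1 (n + m) (-m) hs hk (by omega), map_mul, hσ]
    ring
  rw [hα1 m k hm hk hmk, hσ]
  rcases eq_or_ne k (-(n + m)) with rfl | hnmk
  · rw [hα2 _ hs, show m + -(n + m) = -n by ring, hα2 n hn]
    ring
  · rw [hα1 _ k hs hk hnmk, hα1 n (m + k) hn (by omega) (by omega)]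
    ring
end
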